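/- For every integer k ≥ 1, the Hankel determinant H_{f_{2k+1}/2 + 1, f_{2k+3} − 1} equals (−1)^{k+1} · f_{2k+1}/2. -/

import Mathlib

/-- The substitution τ: 1 → 101, 0 → 1 on the alphabet {0,1}. -/
def tau (b : ℕ) : List ℕ := if b = 1 then [1, 0, 1] else [1]

/-- The iterated word τ^n(1). -/
def tauIter : ℕ → List ℕ
  | 0 => [1]
  | n + 1 => ((tauIter n).map tau).flatten

/-- `s` is the fixed point of τ beginning with 1: it agrees with every
iterate `τ^n(1)` on its length. -/
def IsFixedSeq (s : ℕ → ℕ) : Prop :=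
  ∀ n j, j < (tauIter n).length → s j = (tauIter n).getD j 0

/-- The sequence (f_n): f_0 = 1, f_1 = 2, f_{2n+2} = f_{2n} + f_{2n+1},
f_{2n+3} = f_{2n} + f_{2n+2}. -/
def IsFSeq (f : ℕ → ℕ) : Prop :=
  f 0 = 1 ∧ f 1 = 2 ∧ (∀ n, f (2*n+2) = f (2*n) + f (2*n+1)) ∧
    (∀ n, f (2*n+3) = f (2*n) + f (2*n+2))

/-- `a` is the f-representation of `n`: digits in {0,1}, finitely supported,
a_i a_{i+1} = 0 for all i, a_i a_{i+2} = 0 for even i, and n = Σ a_i f_i. -/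
def IsFRep (f : ℕ → ℕ) (n : ℕ) (a : ℕ → ℕ) : Prop :=
  (∀ i, a i ≤ 1) ∧ (∀ i, a i * a (i+1) = 0) ∧
  (∀ i, Even i → a i * a (i+2) = 0) ∧
  ∃ N, (∀ i, N ≤ i → a i = 0) ∧ n = ∑ i ∈ Finset.range N, a i * f i

/-- The truncated f-representation Φ_k(n) = Σ_{i=0}^{2k+2} a_i(n) f_i. -/
def Phi (f : ℕ → ℕ) (a : ℕ → ℕ → ℕ) (k n : ℕ) : ℕ :=
  ∑ i ∈ Finset.range (2*k+3), a n i * f i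

/-- The Hankel determinant H_{m,n} = det (s_{m+i+j})_{0 ≤ i,j ≤ n-1}. -/
def H (s : ℕ → ℕ) (m n : ℕ) : ℤ :=
  (Matrix.of fun i j : Fin n => (s (m + i.1 + j.1) : ℤ)).det


/-- Rational mechanical word. -/
def Fw (p h b j : ℕ) : ℕ := (h*(j+1)+b)/p - (h*j+b)/p

/-- Number of ones in the prefix. -/
def cnt (s : ℕ → ℕ) (j : ℕ) : ℕ := ∑ i ∈ Finset.range j, s i

lemma tau_flat_length (l : List ℕ) (hl : ∀ a ∈ l, a = 0 ∨ a = 1) :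
    ((l.map tau).flatten).length = l.length + 2 * l.sum := by
  induction l with
  | nil => simp
  | cons a l ih =>
    have h1 := ih (fun a ha => hl a (List.mem_cons_of_mem _ ha))
    simp only [List.map_cons, List.flatten_cons, List.length_append, h1, List.length_cons,
      List.sum_cons]
    rcases hl a List.mem_cons_self with h | h <;> subst h <;> simp [tau] <;> omega

lemma tauIter_mem (n : ℕ) : ∀ a ∈ tauIter n, a = 0 ∨ a = 1 := by
  induction n with
  | zero => simp [tauIter]
  | succ n ih =>
    intro a ha
    simp only [tauIter, List.mem_flatten, List.mem_map] at ha
    obtain ⟨l, ⟨c, hc, rfl⟩, ha⟩ := ha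
    unfold tau at ha
    split_ifs at ha <;> simp at ha <;> omega

lemma tauIter_head (n : ℕ) : ∃ l, tauIter n = 1 :: l := by
  induction n with
  | zero => exact ⟨[], rfl⟩
  | succ n ih =>
    obtain ⟨l, hl⟩ := ih
    exact ⟨_, by rw [tauIter, hl]; simp [tau]; rfl⟩

lemma tauIter_length (n : ℕ) : n < (tauIter n).length := by
  induction n with
  | zero => simp [tauIter]
  | succ n ih =>
    rw [tauIter, tau_flat_length _ (tauIter_mem n)]
    obtain ⟨l, hl⟩ := tauIter_head n
    have : 1 ≤ (tauIter n).sum := by rw [hl]; simp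
    omega

lemma s_01 (s : ℕ → ℕ) (hs : IsFixedSeq s) (j : ℕ) : s j = 0 ∨ s j = 1 := by
  have hl := tauIter_length j
  rw [hs j j hl, List.getD_eq_getElem _ _ hl]
  exact tauIter_mem j _ (List.getElem_mem hl)

lemma s_take (s : ℕ → ℕ) (hs : IsFixedSeq s) (n j : ℕ) (hj : j ≤ (tauIter n).length) :
    ((tauIter n).take j).sum = cnt s j := by
  induction j with
  | zero => simp [cnt]
  | succ j ih =>
    rw [List.take_add_one, List.sum_append, ih (by omega), cnt, cnt, Finset.sum_range_succ,
      hs n j (by omega), List.getElem?_eq_getElem (by omega), List.getD_eq_getElem _ _ (by omega)]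
    simp

/-- The self-similarity of `s`. -/
lemma s_self (s : ℕ → ℕ) (hs : IsFixedSeq s) (j : ℕ) :
    s (j + 2 * cnt s j) = 1 ∧
    (s j = 1 → s (j + 2 * cnt s j + 1) = 0 ∧ s (j + 2 * cnt s j + 2) = 1) := by
  have hl := tauIter_length j
  set l := tauIter j with hldef
  have hsplit : l = l.take j ++ l[j] :: l.drop (j+1) := by simp
  have hsj : s j = l[j] := by rw [hs j j hl, List.getD_eq_getElem _ _ hl]
  have hpre : (((l.take j).map tau).flatten).length = j + 2 * cnt s j := by
    rw [tau_flat_length _ (fun a ha => tauIter_mem j a (List.mem_of_mem_take ha)),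
      s_take s hs j j hl.le, List.length_take, Nat.min_eq_left hl.le]
  have hnext : tauIter (j+1) = ((l.take j).map tau).flatten ++
      (tau l[j] ++ ((l.drop (j+1)).map tau).flatten) := by
    rw [tauIter, ← hldef]
    conv_lhs => rw [hsplit]
    rw [List.map_append, List.map_cons, List.flatten_append, List.flatten_cons]
  have key : ∀ d, d < (tau l[j]).length → s (j + 2 * cnt s j + d) = (tau l[j]).getD d 0 := by
    intro d hd
    rw [hs (j+1) _ (by rw [hnext]; simp only [List.length_append, hpre]; omega), hnext,
      List.getD_append_right _ _ _ _ (by rw [hpre]; omega), hpre,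
      List.getD_append _ _ _ _ (by omega)]
    congr 1; omega
  rw [hsj]
  rcases tauIter_mem j l[j] (List.getElem_mem hl) with h | h <;> rw [h] at key ⊢
  · exact ⟨key 0 (by simp [tau]), by simp⟩
  · exact ⟨key 0 (by simp [tau]), fun _ => ⟨key 1 (by simp [tau]), key 2 (by simp [tau])⟩⟩

lemma Fw_cnt (s : ℕ → ℕ) (p h b L : ℕ) (hb : b < p)
    (hF : ∀ j < L, s j = Fw p h b j) : ∀ j ≤ L, cnt s j = (h*j+b)/p := by
  intro j hj
  induction j with
  | zero => simp [cnt, Nat.div_eq_of_lt hb]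
  | succ j ih =>
    have := ih (by omega)
    rw [cnt] at this ⊢
    rw [Finset.sum_range_succ, this, hF j (by omega), Fw]
    have : (h*j+b)/p ≤ (h*(j+1)+b)/p := Nat.div_le_div_right (by nlinarith)
    omega

lemma Fw_one (p h b j N : ℕ) (r : ℕ) (hr : h * j + b = p * N + r) (hh : h < p) (h1 : r < p)
    (h2 : p ≤ r + h) : Fw p h b j = 1 := by
  have e1 : (h*j+b)/p = N := by
    rw [hr, Nat.mul_add_div (by omega), Nat.div_eq_of_lt h1]; omega
  have e2 : (h*(j+1)+b)/p = N + 1 := by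
    have : h*(j+1)+b = p * (N+1) + (r + h - p) := by
      zify [h2]; zify at hr; linarith
    rw [this, Nat.mul_add_div (by omega), Nat.div_eq_of_lt (by omega)]
  rw [Fw, e1, e2]; omega

lemma Fw_zero (p h b j N : ℕ) (r : ℕ) (hr : h * j + b = p * N + r)
    (h2 : r + h < p) : Fw p h b j = 0 := by
  have e1 : (h*j+b)/p = N := by
    rw [hr, Nat.mul_add_div (by omega), Nat.div_eq_of_lt (by omega)]; omega
  have e2 : (h*(j+1)+b)/p = N := by
    have : h*(j+1)+b = p * N + (r + h) := by linarith
    rw [this, Nat.mul_add_div (by omega), Nat.div_eq_of_lt (by omega)]; omega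
  rw [Fw, e1, e2]; omega

lemma step (s : ℕ → ℕ) (hs : IsFixedSeq s) (p h b L N : ℕ) (hh : h < p) (h0 : 0 < h)
    (hb : b < p) (hF : ∀ j < L, s j = Fw p h b j) (hN : (h*L+b)/p = N) :
    ∀ j < L + 2*N + 1, s j = Fw (p+2*h) (p+h) (p+h-1-b) j := by
  have hc := Fw_cnt s p h b L hb hF
  -- data at a block start
  have blk : ∀ j ≤ L, ∃ r, r < p ∧ h*j+b = p * cnt s j + r ∧
      (p+h) * (j + 2 * cnt s j) + (p+h-1-b) = (p+2*h) * (j + cnt s j) + (p+h-1-r) := by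
    intro j hj
    refine ⟨(h*j+b)%p, Nat.mod_lt _ (by omega), ?_, ?_⟩
    · rw [hc j hj]; exact (Nat.div_add_mod _ _).symm
    · have e : h*j+b = p * cnt s j + (h*j+b)%p := by
        rw [hc j hj]; exact (Nat.div_add_mod _ _).symm
      have := Nat.mod_lt (h*j+b) (show 0 < p by omega)
      generalize (h*j+b)%p = r at *
      zify [show b ≤ p+h-1 by omega, show r ≤ p+h-1 by omega, show 1 ≤ p + h by omega]
      zify at e
      linarith
  have first : ∀ j ≤ L, s (j + 2 * cnt s j) = Fw (p+2*h) (p+h) (p+h-1-b) (j + 2 * cnt s j) := by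
    intro j hj
    obtain ⟨r, hr, e, e'⟩ := blk j hj
    rw [(s_self s hs j).1, Fw_one _ _ _ _ _ _ e' (by omega) (by omega) (by omega)]
  have main : ∀ j ≤ L, ∀ x < j + 2 * cnt s j, s x = Fw (p+2*h) (p+h) (p+h-1-b) x := by
    intro j
    induction j with
    | zero => simp [cnt]
    | succ j ih =>
      intro hj x hx
      have ih := ih (by omega)
      by_cases hx1 : x < j + 2 * cnt s j
      · exact ih x hx1
      by_cases hx2 : x = j + 2 * cnt s j
      · rw [hx2]; exact first j (by omega)
      have hcs : cnt s (j+1) = cnt s j + s j := by simp [cnt, Finset.sum_range_succ]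
      rcases s_01 s hs j with h01 | h01
      · omega
      obtain ⟨r, hr, e, e'⟩ := blk j (by omega)
      have hrr : p ≤ r + h := by
        by_contra hlt
        have := Fw_zero p h b j _ r e (by omega)
        rw [← hF j (by omega)] at this
        omega
      have hself := (s_self s hs j).2 h01
      have e1 : (p+h) * (j + 2 * cnt s j + 1) + (p+h-1-b)
          = (p+2*h) * (j + cnt s j + 1) + (p-1-r) := by
        zify [show b ≤ p+h-1 by omega, show r ≤ p+h-1 by omega, show 1 ≤ p + h by omega,
          show r ≤ p - 1 by omega, show 1 ≤ p by omega] at e' ⊢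
        linarith
      have e2 : (p+h) * (j + 2 * cnt s j + 2) + (p+h-1-b)
          = (p+2*h) * (j + cnt s j + 1) + (p-1-r+(p+h)) := by
        linarith
      have hx3 : x = j + 2 * cnt s j + 1 ∨ x = j + 2 * cnt s j + 2 := by omega
      rcases hx3 with hx3 | hx3
      · rw [hx3, hself.1, Fw_zero _ _ _ _ _ _ e1 (by omega)]
      · rw [hx3, hself.2, Fw_one _ _ _ _ _ _ e2 (by omega) (by omega) (by omega)]
  intro j hj
  have hcL : cnt s L = N := by rw [hc L le_rfl, hN]
  by_cases hj2 : j < L + 2 * N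
  · exact main L le_rfl j (by rw [hcL]; exact hj2)
  · have : j = L + 2 * cnt s L := by omega
    rw [this]; exact first L le_rfl

/-- Auxiliary circulant. -/
def Kmat (p : ℕ) (t : ℚ) (g : ZMod p) : Matrix (ZMod p) (ZMod p) ℚ :=
  Matrix.of fun u v => (if v = u then 1 else 0) - (if v = u + g then 1 else 0) + t

/-- Circulant of `h` consecutive ones. -/
def Amat (p h : ℕ) : Matrix (ZMod p) (ZMod p) ℚ :=
  Matrix.of fun u v => if (v - u).val < h then 1 else 0

lemma Kmat_scale (p : ℕ) [NeZero p] (t : ℚ) (u : (ZMod p)ˣ) :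
    (Kmat p t u).det = (Kmat p t 1).det := by
  rw [← Matrix.det_submatrix_equiv_self (Units.mulLeft u : ZMod p ≃ ZMod p)]
  congr 1
  ext i j
  have h1 : ((u:ZMod p) * j = u * i) ↔ j = i := u.mul_right_inj
  have h2 : ((u:ZMod p) * j = u * i + u) ↔ j = i + 1 := by
    rw [show (u:ZMod p) * i + u = u * (i+1) by ring]; exact u.mul_right_inj
  simp only [Kmat, Matrix.submatrix_apply, Matrix.of_apply, Units.mulLeft_apply, h1, h2]

lemma Kmat_mulVec (p : ℕ) [NeZero p] (t : ℚ) (g u : ZMod p) (x : ZMod p → ℚ) :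
    (Kmat p t g).mulVec x u = x u - x (u+g) + t * ∑ v, x v := by
  simp [Kmat, Matrix.mulVec, dotProduct, add_mul, sub_mul, Finset.sum_add_distrib,
    Finset.mul_sum]

lemma Kmat_det_ne (p : ℕ) [NeZero p] : (Kmat p 1 1).det ≠ 0 := by
  intro h0
  obtain ⟨x, hx, h⟩ := Matrix.exists_mulVec_eq_zero_iff.mpr h0
  have h1 : ∀ u, x u - x (u+1) + ∑ v, x v = 0 := by
    intro u
    have := congrFun h u
    rw [Kmat_mulVec, one_mul] at this
    exact this
  have hp : (p:ℚ) ≠ 0 := by exact_mod_cast NeZero.ne p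
  have hsum : ∑ v, x v = 0 := by
    have h2 : ∑ u, (x u - x (u+1) + ∑ v, x v) = 0 := Finset.sum_eq_zero (fun u _ => h1 u)
    have h2' : ∑ u, x (u+1) = ∑ u, x u := Equiv.sum_comp (Equiv.addRight (1:ZMod p)) x
    rw [Finset.sum_add_distrib, Finset.sum_sub_distrib, h2'] at h2
    simp [ZMod.card, hp] at h2
    exact h2
  have h3 : ∀ n : ℕ, x (n : ZMod p) = x 0 := by
    intro n
    induction n with
    | zero => simp
    | succ n ih =>
      have := h1 n
      rw [hsum, ih] at this
      push_cast; linarith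
  have h4 : ∀ u, x u = x 0 := fun u => by
    have := h3 u.val; rwa [ZMod.natCast_zmod_val] at this
  have h5 : x 0 = 0 := by
    rw [Finset.sum_congr rfl (fun u _ => h4 u)] at hsum
    simpa [ZMod.card, hp] using hsum
  apply hx; ext u; rw [h4 u, h5]; rfl

lemma Amat_colsum (p h : ℕ) [NeZero p] (hh : h < p) (v : ZMod p) :
    ∑ u, Amat p h u v = h := by
  have : ∑ u, Amat p h u v = ∑ w : ZMod p, if w.val < h then (1:ℚ) else 0 :=
    Equiv.sum_comp (Equiv.subLeft v) (fun w : ZMod p => if w.val < h then (1:ℚ) else 0)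
  rw [this, Finset.sum_boole]
  norm_cast
  have : (Finset.univ.filter (fun w : ZMod p => w.val < h)) =
      (Finset.range h).image (fun n : ℕ => (n : ZMod p)) := by
    ext w
    simp only [Finset.mem_filter, Finset.mem_univ, true_and, Finset.mem_image, Finset.mem_range]
    constructor
    · intro hw; exact ⟨w.val, hw, ZMod.natCast_zmod_val w⟩
    · rintro ⟨n, hn, rfl⟩
      rwa [ZMod.val_natCast, Nat.mod_eq_of_lt (by omega)]
  rw [this, Finset.card_image_of_injOn, Finset.card_range]
  intro a ha c hc hac
  simp only [Finset.coe_range, Set.mem_Iio] at ha hc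
  have := congrArg ZMod.val hac
  rwa [ZMod.val_natCast, ZMod.val_natCast, Nat.mod_eq_of_lt (by omega),
    Nat.mod_eq_of_lt (by omega)] at this

lemma Amat_diff (p h : ℕ) [NeZero p] (h0 : 0 < h) (hh : h < p) (u v : ZMod p) :
    Amat p h u v - Amat p h (u+1) v =
      (if v = u then 1 else 0) - (if v = u + (h:ZMod p) then 1 else 0) := by
  obtain ⟨w, rfl⟩ : ∃ w, v = u + w := ⟨v - u, by ring⟩
  have e1 : u + w - u = w := by ring
  have e2 : u + w - (u+1) = w - 1 := by ring
  simp only [Amat, Matrix.of_apply, e1, e2, add_right_inj, add_eq_left]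
  obtain ⟨n, hn, rfl⟩ : ∃ n < p, w = (n : ZMod p) :=
    ⟨w.val, ZMod.val_lt w, (ZMod.natCast_zmod_val w).symm⟩
  have inj : ∀ a c : ℕ, a < p → c < p → ((a : ZMod p) = c ↔ a = c) := by
    intro a c ha hc
    rw [ZMod.natCast_eq_natCast_iff', Nat.mod_eq_of_lt ha, Nat.mod_eq_of_lt hc]
  have i0 : ((n : ZMod p) = 0 ↔ n = 0) := by
    have := inj n 0 hn (by omega); simpa using this
  simp only [i0, inj n h hn hh]
  rw [ZMod.val_natCast, Nat.mod_eq_of_lt hn]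
  rcases Nat.eq_zero_or_pos n with rfl | hpos
  · have : ((0:ℕ) : ZMod p) - 1 = ((p - 1 : ℕ) : ZMod p) := by
      rw [Nat.cast_sub (by omega)]; simp
    rw [this, ZMod.val_natCast, Nat.mod_eq_of_lt (by omega)]
    simp [h0, show ¬ (p - 1 < h) by omega, show (0 ≠ h) by omega]
  · have : (n : ZMod p) - 1 = ((n - 1 : ℕ) : ZMod p) := by
      rw [Nat.cast_sub (by omega)]; simp
    rw [this, ZMod.val_natCast, Nat.mod_eq_of_lt (by omega)]
    by_cases c1 : n < h
    · simp [c1, show n - 1 < h by omega, show n ≠ 0 by omega, show n ≠ h by omega]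
    · by_cases c2 : n = h
      · subst c2; simp [h0, show n ≠ 0 by omega]
      · simp [c1, c2, show ¬ (n - 1 < h) by omega, show n ≠ 0 by omega]

lemma Amat_det (p h : ℕ) [NeZero p] (h0 : 0 < h) (hh : h < p) (hc : Nat.Coprime h p) :
    (Amat p h).det = h := by
  have hp : (p:ℚ) ≠ 0 := by exact_mod_cast NeZero.ne p
  have e1 : Kmat p 1 1 * Amat p h = Kmat p h h := by
    ext u v
    have := Kmat_mulVec p 1 1 u (fun w => Amat p h w v)
    rw [Amat_colsum p h hh v, Amat_diff p h h0 hh u v, one_mul] at this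
    exact this
  have e2 : Kmat p 1 h * (1 + Matrix.replicateCol Unit (fun _ => ((h:ℚ)-1)/p) *
      Matrix.replicateRow Unit (fun _ : ZMod p => (1:ℚ))) = Kmat p h h := by
    rw [mul_add, mul_one]
    ext u v
    have := Kmat_mulVec p 1 h u (fun w => ((h:ℚ)-1)/p)
    rw [Matrix.add_apply, Matrix.mul_apply]
    rw [Matrix.mulVec, dotProduct] at this
    simp only [Matrix.mul_apply, Matrix.replicateCol_apply, Matrix.replicateRow_apply, mul_one,
      Finset.univ_unique, Finset.sum_singleton]
    rw [this]
    simp only [Finset.sum_const, Finset.card_univ, ZMod.card, nsmul_eq_mul]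
    rw [mul_div_cancel₀ _ hp]
    simp only [Kmat, Matrix.of_apply]
    ring
  have d1 := congrArg Matrix.det e1
  have d2 := congrArg Matrix.det e2
  rw [Matrix.det_mul] at d1 d2
  rw [Matrix.det_one_add_replicateCol_mul_replicateRow] at d2
  have d3 := Kmat_scale p 1 (ZMod.unitOfCoprime h hc)
  rw [ZMod.coe_unitOfCoprime] at d3
  rw [d3, ← d1] at d2
  have := mul_left_cancel₀ (Kmat_det_ne p) d2
  rw [← this]
  simp [dotProduct, ZMod.card]
  field_simp
  ring

lemma sign_rev (y : ℕ) : Equiv.Perm.sign (Fin.revPerm : Equiv.Perm (Fin (2*y))) = (-1)^y := by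
  rw [Equiv.Perm.sign_eq_prod_prod_Iio]
  have : ∀ j : Fin (2*y), ∏ i ∈ Finset.Iio j,
      (if (Fin.revPerm i : Fin (2*y)) < Fin.revPerm j then (1:ℤˣ) else -1) = (-1)^(j:ℕ) := by
    intro j
    rw [Finset.prod_congr rfl (g := fun _ => (-1:ℤˣ))]
    · simp
    · intro i hi
      have hi := Finset.mem_Iio.mp hi
      simp [hi.le]
  rw [Finset.prod_congr rfl (fun j _ => this j), Fin.prod_univ_eq_prod_range (fun j => (-1:ℤˣ)^j)]
  clear this
  induction y with
  | zero => simp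
  | succ y ih =>
    rw [show 2*(y+1) = 2*y+1+1 by ring, Finset.prod_range_succ, Finset.prod_range_succ, ih,
      pow_succ, pow_succ, pow_mul]
    simp

lemma sign_rot (n : ℕ) : Equiv.Perm.sign (Equiv.addRight (1 : ZMod (n+1))) = (-1)^n := by
  have : (Equiv.addRight (1 : ZMod (n+1)) : Equiv.Perm (Fin (n+1))) = finRotate (n+1) := by
    ext i
    rw [finRotate_apply]; rfl
  have h := sign_finRotate (n+1)
  rw [← this] at h
  exact h

lemma zmod_rev (n : ℕ) (i r : ZMod (n+1)) (h : i.val + r.val + 1 = n + 1) : -1 - i = r := by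
  have h2 := congrArg (Nat.cast : ℕ → ZMod (n+1)) h
  have h3 := ZMod.natCast_self (n+1)
  rw [h3] at h2
  push_cast at h2
  rw [ZMod.natCast_zmod_val, ZMod.natCast_zmod_val] at h2
  linear_combination -h2

lemma sign_revZ (n y : ℕ) (hy : n + 1 = 2 * y) :
    Equiv.Perm.sign (Equiv.subLeft (-1 : ZMod (n+1))) = (-1)^y := by
  have h := sign_rev y
  rw [← hy] at h
  have : (Equiv.subLeft (-1 : ZMod (n+1)) : Equiv.Perm (Fin (n+1))) = Fin.revPerm := by
    apply Equiv.ext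
    intro i
    have hv : i.val + (Fin.rev i).val + 1 = n + 1 := by rw [Fin.val_rev]; omega
    exact zmod_rev n i (Fin.rev i) hv
  rw [← this] at h
  exact h

lemma sign_refl (n y : ℕ) (hy : n + 1 = 2 * y) (β : ℕ) :
    Equiv.Perm.sign (Equiv.subLeft (-(β : ZMod (n+1)))) = (-1)^(y+β+1) := by
  have hn : Odd n := by rw [← Nat.not_even_iff_odd]; rintro ⟨a, ha⟩; omega
  have hrec : ∀ β : ℕ, Equiv.Perm.sign (Equiv.subLeft (-((β+1 : ℕ) : ZMod (n+1)))) =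
      - Equiv.Perm.sign (Equiv.subLeft (-(β : ZMod (n+1)))) := by
    intro β
    have : Equiv.subLeft (-((β+1 : ℕ) : ZMod (n+1))) =
      (Equiv.subLeft (-(β : ZMod (n+1))) : Equiv.Perm (ZMod (n+1))) * Equiv.addRight 1 := by
      apply Equiv.ext; intro i
      simp [Equiv.Perm.mul_apply]; ring
    rw [this, Equiv.Perm.sign_mul, sign_rot, hn.neg_one_pow]
    simp
  induction β with
  | zero =>
    have h1 := hrec 0
    have h2 := sign_revZ n y hy
    simp only [zero_add, Nat.cast_one] at h1
    rw [h2] at h1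
    rw [pow_succ, h1]; simp
  | succ β ih => rw [hrec, ih, ← add_assoc, pow_succ (-1 : ℤˣ) (y+β+1)]; simp

lemma Fw_zmod (p h b j : ℕ) [NeZero p] (hh : h < p) :
    Fw p h b j = if (((h*j+b+h : ℕ)) : ZMod p).val < h then 1 else 0 := by
  have hp : 0 < p := by omega
  have hr := Nat.mod_lt (h*j+b) hp
  have e := (Nat.div_add_mod (h*j+b) p).symm
  rw [ZMod.val_natCast]
  generalize (h*j+b)%p = r at *
  generalize (h*j+b)/p = N at *
  by_cases c : p ≤ r + h
  · rw [Fw_one p h b j N r e hh hr c, if_pos]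
    have : h*j+b+h = (r + h - p) + p * (N+1) := by
      rw [e]; zify [c]; ring
    rw [this, Nat.add_mul_mod_self_left, Nat.mod_eq_of_lt (by omega)]; omega
  · rw [Fw_zero p h b j N r e (by omega), if_neg]
    have : h*j+b+h = (r + h) + p * N := by rw [e]; ring
    rw [this, Nat.add_mul_mod_self_left, Nat.mod_eq_of_lt (by omega)]; omega

lemma detC (n y h b m : ℕ) (hy : n + 1 = 2 * y) (h0 : 0 < h) (hh : h < n + 1)
    (hc : Nat.Coprime h (n+1)) :
    (Matrix.of fun i j : ZMod (n+1) => ((Fw (n+1) h b (m + i.val + j.val) : ℕ) : ℚ)).det =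
      (-1)^(y + (h*(m+1)+b) + 1) * h := by
  set β := h*(m+1)+b with hβ
  have key : (Matrix.of fun i j : ZMod (n+1) => ((Fw (n+1) h b (m + i.val + j.val) : ℕ) : ℚ)) =
      ((Amat (n+1) h).submatrix (Equiv.subLeft (-(β : ZMod (n+1)))) id).submatrix
        (Units.mulLeft (ZMod.unitOfCoprime h hc) : ZMod (n+1) ≃ ZMod (n+1))
        (Units.mulLeft (ZMod.unitOfCoprime h hc)) := by
    ext i j
    simp only [Matrix.of_apply, Matrix.submatrix_apply, Amat, Units.mulLeft_apply,
      ZMod.coe_unitOfCoprime, Equiv.subLeft_apply, id]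
    rw [Fw_zmod (n+1) h b _ hh]
    have : ((h * (m + i.val + j.val) + b + h : ℕ) : ZMod (n+1)) =
        h * j - (-(β:ZMod (n+1)) - h * i) := by
      rw [hβ]
      push_cast
      rw [ZMod.natCast_zmod_val, ZMod.natCast_zmod_val]
      ring
    rw [this]
    push_cast
    rfl
  rw [key, Matrix.det_submatrix_equiv_self, Matrix.det_permute, sign_refl n y hy,
    Amat_det (n+1) h h0 hh hc]
  push_cast
  rfl

lemma Fw_sum (p h b a l : ℕ) :
    ∑ j ∈ Finset.range l, (Fw p h b (a+j) : ℤ) = ((h*(a+l)+b)/p : ℕ) - ((h*a+b)/p : ℕ) := by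
  induction l with
  | zero => simp
  | succ l ih =>
    rw [Finset.sum_range_succ, ih, Fw]
    have : (h*(a+l)+b)/p ≤ (h*(a+l+1)+b)/p := Nat.div_le_div_right (by nlinarith)
    rw [Nat.cast_sub this, ← add_assoc]
    ring

lemma div_eval (p N r A : ℕ) (hr : r < p) (h : A = p * N + r) : A / p = N := by
  rw [h, Nat.mul_add_div (by omega), Nat.div_eq_of_lt hr]; omega

lemma window_count (x y b : ℕ) (ε : ℤ) (hx : 0 < x) (hxy : x < y)
    (hε : ((x:ℤ)+y)^2 = 2*y^2+ε) (hb : (ε = 1 ∧ b + 1 = y) ∨ (ε = -1 ∧ b = y))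
    (hc : Nat.Coprime (x+y) (2*y)) (hodd : Odd (x+y)) (i : ℕ) (hi : i < 2*y) :
    ((((x+y)*(x+1+i+2*y)+b)/(2*y) : ℕ) : ℤ) =
      (((x+y)*(y+1+i)+b)/(2*y) : ℕ) + y + (if i + 1 = 2*y then ε else 0) := by
  have hp : 0 < 2*y := by omega
  obtain ⟨N, r, hr, e⟩ : ∃ N r, r < 2*y ∧ (x+y)*(y+1+i)+b = 2*y*N+r :=
    ⟨_, _, Nat.mod_lt _ hp, (Nat.div_add_mod _ _).symm⟩
  rw [div_eval _ N r _ hr e]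
  have e3 : (((x+y)*(x+1+i+2*y)+b : ℕ) : ℤ) = 2*y*(N+y) + (r + ε) := by
    zify at e
    push_cast
    linear_combination e + hε
  obtain ⟨q, hq⟩ := hodd
  by_cases hlast : i + 1 = 2*y
  · rw [if_pos hlast]
    have e4 : (x+y)*(y+1+i)+b = 2*y*(3*q) + (3*y+b) := by
      rw [show y+1+i = 3*y by omega, hq]; ring
    rcases hb with ⟨rfl, hb⟩ | ⟨rfl, rfl⟩
    · have hN := div_eval _ N r _ hr e
      have hN' := div_eval (2*y) (3*q+1) (2*y-1) _ (by omega) (show (x+y)*(y+1+i)+b = 2*y*(3*q+1) + (2*y-1) by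
        rw [e4, mul_add]; omega)
      have hNN : N = 3*q+1 := by omega
      have hrr : r = 2*y-1 := by
        have : 2*y*N + r = 2*y*N + (2*y-1) := by rw [← e, e4, hNN, mul_add]; omega
        omega
      rw [div_eval (2*y) (N+y+1) 0 _ hp]
      · push_cast; ring
      · zify; rw [show (r:ℤ) = 2*y-1 by omega] at e3; push_cast at e3; linarith
    · have hN := div_eval _ N r _ hr e
      have hN' := div_eval (2*b) (3*q+2) 0 _ (by omega) (show (x+b)*(b+1+i)+b = 2*b*(3*q+2) + 0 by
        rw [e4]; ring)
      have hNN : N = 3*q+2 := by omega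
      have hrr : r = 0 := by
        have : 2*b*N + r = 2*b*N + 0 := by rw [← e, e4, hNN]; ring
        omega
      have h1 : (((x+b)*(x+1+i+2*b)+b : ℕ) : ℤ) = ((2*b*(N+b-1)+(2*b-1) : ℕ) : ℤ) := by
        rw [e3, hrr]; push_cast [show 1 ≤ N + b by omega, show 1 ≤ 2*b by omega]; ring
      rw [div_eval (2*b) (N+b-1) (2*b-1) _ (by omega) (by exact_mod_cast h1)]
      push_cast [show 1 ≤ N + b by omega]; ring
  · rw [if_neg hlast]
    have nodvd : ∀ K : ℕ, (x+y)*(y+1+i)+y ≠ 2*y*K := by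
      intro K hK
      have h1 : (x+y)*(1+i) + 2*y*(q+1) = 2*y*K := by
        rw [← hK]
        have : (x+y)*(y+1+i) = (x+y)*(1+i) + (x+y)*y := by ring
        rw [this]
        have : (x+y)*y = 2*y*q + y := by rw [hq]; ring
        rw [this]; ring
      have h2 : 2*y ∣ (x+y)*(1+i) :=
        (Nat.dvd_add_iff_left (Dvd.intro _ rfl)).mpr (Dvd.intro _ h1.symm)
      have h3 := hc.symm.dvd_of_dvd_mul_left h2
      have := Nat.le_of_dvd (by omega) h3
      omega
    rcases hb with ⟨rfl, hb⟩ | ⟨rfl, rfl⟩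
    · have hne : r + 1 ≠ 2*y := by
        intro h
        apply nodvd (N+1)
        have : 2*y*(N+1) = 2*y*N + 2*y := by ring
        omega
      rw [div_eval (2*y) (N+y) (r+1) _ (by omega)]
      · push_cast; ring
      · zify; linarith
    · have hne : r ≠ 0 := by
        intro h
        apply nodvd N
        rw [e, h]; ring
      have h1 : (((x+b)*(x+1+i+2*b)+b : ℕ) : ℤ) = ((2*b*(N+b)+(r-1) : ℕ) : ℤ) := by
        rw [e3]; push_cast [show 1 ≤ r by omega]; ring
      rw [div_eval (2*b) (N+b) (r-1) _ (by omega) (by exact_mod_cast h1)]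
      push_cast; ring

lemma window_sum (x y b : ℕ) (ε : ℤ) (hx : 0 < x) (hxy : x < y)
    (hε : ((x:ℤ)+y)^2 = 2*y^2+ε) (hb : (ε = 1 ∧ b + 1 = y) ∨ (ε = -1 ∧ b = y))
    (hc : Nat.Coprime (x+y) (2*y)) (hodd : Odd (x+y)) (i : ℕ) (hi : i < 2*y) :
    ∑ j ∈ Finset.range (2*y), (Fw (2*y) (x+y) b (x+1+i+j) : ℤ) *
      (if y - x ≤ j then (x:ℤ) else -(y:ℤ)) = if i + 1 = 2*y then ε * (x+y) else 0 := by
  have hw := window_count x y b ε hx hxy hε hb hc hodd i hi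
  rw [show 2*y = (y-x) + (x+y) by omega] 
  rw [Finset.sum_range_add]
  rw [← show 2*y = (y-x) + (x+y) by omega] 
  have s1 : ∑ j ∈ Finset.range (y-x), (Fw (2*y) (x+y) b (x+1+i+j) : ℤ) *
      (if y - x ≤ j then (x:ℤ) else -(y:ℤ)) =
      (∑ j ∈ Finset.range (y-x), (Fw (2*y) (x+y) b (x+1+i+j) : ℤ)) * (-(y:ℤ)) := by
    rw [Finset.sum_mul]
    refine Finset.sum_congr rfl fun j hj => ?_
    have := Finset.mem_range.mp hj
    rw [if_neg (by omega)]
  have s2 : ∑ j ∈ Finset.range (x+y), (Fw (2*y) (x+y) b (x+1+i+(y-x+j)) : ℤ) *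
      (if y - x ≤ y - x + j then (x:ℤ) else -(y:ℤ)) =
      (∑ j ∈ Finset.range (x+y), (Fw (2*y) (x+y) b (y+1+i+j) : ℤ)) * (x:ℤ) := by
    rw [Finset.sum_mul]
    refine Finset.sum_congr rfl fun j hj => ?_
    rw [if_pos (by omega), show x+1+i+(y-x+j) = y+1+i+j by omega]
  rw [s1, s2, Fw_sum, Fw_sum, show x+1+i+(y-x) = y+1+i by omega,
    show y+1+i+(x+y) = x+1+i+2*y by omega, hw]
  have hper : ((x+y)*(x+1+i+2*y)+b)/(2*y) = ((x+y)*(x+1+i)+b)/(2*y) + (x+y) := by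
    rw [show (x+y)*(x+1+i+2*y)+b = ((x+y)*(x+1+i)+b) + (x+y)*(2*y) by ring,
      Nat.add_mul_div_right _ _ (by omega)]
  rw [hper] at hw
  push_cast at hw ⊢
  split_ifs at hw ⊢ with h1
  · linear_combination (y:ℤ) * hw
  · linear_combination (y:ℤ) * hw

lemma odd_h (x y : ℕ) (ε : ℤ) (hε : ((x:ℤ)+y)^2 = 2*y^2+ε) (h : ε = 1 ∨ ε = -1) :
    Odd (x+y) := by
  have h1 : Odd (((x:ℤ)+y)^2) := by
    rw [hε]
    rcases h with rfl | rfl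
    · exact ⟨y^2, rfl⟩
    · exact ⟨y^2-1, by ring⟩
  have h2 : Odd ((x:ℤ)+y) := by
    rcases Int.even_or_odd ((x:ℤ)+y) with h | h
    · exact absurd h1 (Int.not_odd_iff_even.mpr (h.pow_of_ne_zero (by norm_num)))
    · exact h
  exact_mod_cast h2

lemma coprime_h (x y : ℕ) (ε : ℤ) (hε : ((x:ℤ)+y)^2 = 2*y^2+ε) (h : ε = 1 ∨ ε = -1) :
    Nat.Coprime (x+y) (2*y) := by
  rw [← Nat.isCoprime_iff_coprime]
  refine ⟨ε*(x+y), -ε*y, ?_⟩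
  push_cast
  have : ε^2 = 1 := by rcases h with rfl | rfl <;> norm_num
  linear_combination ε * hε + this

lemma minor (x y b n : ℕ) (ε : ℤ) (hx : 0 < x) (hxy : x < y) (hn : n + 1 = 2*y)
    (hε : ((x:ℤ)+y)^2 = 2*y^2+ε) (hb : (ε = 1 ∧ b + 1 = y) ∨ (ε = -1 ∧ b = y)) (hbo : Odd b) :
    (Matrix.of fun i j : Fin n => (Fw (2*y) (x+y) b (x+1+i.1+j.1) : ℤ)).det = -ε * x := by
  have hε1 : ε = 1 ∨ ε = -1 := hb.imp And.left And.left
  have hc := coprime_h x y ε hε hε1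
  have hodd := odd_h x y ε hε hε1
  have hw := window_sum x y b ε hx hxy hε hb hc hodd
  rw [← hn] at hw hc ⊢
  set C : Matrix (Fin (n+1)) (Fin (n+1)) ℤ :=
    Matrix.of fun i j => (Fw (n+1) (x+y) b (x+1+i.1+j.1) : ℤ) with hC
  have hdet : C.det = -((x:ℤ)+y) := by
    have h1 : ((C.det : ℤ) : ℚ) = (-1)^(y + ((x+y)*(x+1+1)+b) + 1) * ((x+y : ℕ) : ℚ) := by
      have h2 := detC n y (x+y) b (x+1) hn (by omega) (by omega) hc
      rw [← h2, Int.cast_det]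
      rfl
    have h3 : Odd (y + ((x+y)*(x+1+1)+b) + 1) := by
      obtain ⟨q, hq⟩ := hodd
      obtain ⟨c, hc'⟩ := hbo
      refine ⟨q*(x+2) + q + 2 + c, ?_⟩
      rw [hq, hc']
      have : (2*q+1)*(x+1+1) = 2*(q*(x+2)) + x + 2 := by ring
      rw [this]; omega
    rw [h3.neg_one_pow] at h1
    have : ((C.det : ℤ) : ℚ) = ((-((x:ℤ)+y) : ℤ) : ℚ) := by rw [h1]; push_cast; ring
    exact_mod_cast this
  let v : Fin (n+1) → ℤ := fun j => if y - x ≤ j.1 then (x:ℤ) else -(y:ℤ)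
  have hCv : C.mulVec v = Pi.single (Fin.last n) (ε * (x+y)) := by
    ext i
    have h1 := hw i.1 i.2
    rw [Finset.sum_range] at h1
    rw [Matrix.mulVec, dotProduct]
    refine h1.trans ?_
    by_cases hi : i = Fin.last n
    · subst hi; simp
    · rw [Pi.single_eq_of_ne hi, if_neg]
      intro h; apply hi; ext; simp; omega
  have hadj : C.adjugate.mulVec (C.mulVec v) = C.det • v := by
    rw [Matrix.mulVec_mulVec, Matrix.adjugate_mul, Matrix.smul_mulVec, Matrix.one_mulVec]
  have h4 := congrFun hadj (Fin.last n)
  rw [hCv, hdet] at h4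
  have hv : v (Fin.last n) = x := by
    simp only [v, Fin.val_last]; rw [if_pos (by omega)]
  rw [Pi.smul_apply, hv, Matrix.mulVec_single] at h4
  have h5 : C.adjugate (Fin.last n) (Fin.last n) * (ε * (x+y)) = -((x:ℤ)+y) * x := h4
  rw [Matrix.adjugate_fin_succ_eq_det_submatrix, (Even.add_self _).neg_one_pow, one_mul] at h5
  have h6 : C.submatrix (Fin.last n).succAbove (Fin.last n).succAbove =
      Matrix.of fun i j : Fin n => (Fw (n+1) (x+y) b (x+1+i.1+j.1) : ℤ) := by
    ext i j
    simp [hC]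
  rw [h6] at h5
  have hε2 : ε * ε = 1 := by rcases hε1 with rfl | rfl <;> norm_num
  have hne : (x:ℤ) + y ≠ 0 := by positivity
  apply mul_right_cancel₀ hne
  linear_combination ε * h5 - (Matrix.of fun i j : Fin n =>
    (Fw (n+1) (x+y) b (x+1+i.1+j.1) : ℤ)).det * (x+y) * hε2

lemma invariant (f : ℕ → ℕ) (hf : IsFSeq f) (s : ℕ → ℕ) (hs : IsFixedSeq s) (k : ℕ) :
    ∃ x y b : ℕ, f (2*k+1) = 2*x ∧ f (2*k+2) = x + y ∧ f (2*k+3) = 2*y ∧ 0 < x ∧ x < y ∧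
      ((x:ℤ)+y)^2 = 2*y^2+(-1)^k ∧
      (((-1:ℤ)^k = 1 ∧ b + 1 = y) ∨ ((-1:ℤ)^k = -1 ∧ b = y)) ∧ Odd b ∧
      ∀ j < x + 4*y - 1, s j = Fw (2*y) (x+y) b j := by
  obtain ⟨f0, f1, fe, fo⟩ := hf
  induction k with
  | zero =>
    refine ⟨1, 2, 1, by simpa using f1, ?_, ?_, by norm_num, by norm_num, by norm_num,
      by norm_num, by decide, ?_⟩
    · have := fe 0; simp at this ⊢; omega
    · have := fe 0; have := fo 0; simp at *; omega
    · intro j hj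
      have hl : (tauIter 3).length = 17 := by decide
      rw [hs 3 j (by omega)]
      have hj : j < 8 := by omega
      interval_cases j <;> decide
  | succ k ih =>
    obtain ⟨x, y, b, h1, h2, h3, hx, hxy, hε, hb, hbo, hF⟩ := ih
    have hodd : Odd (x+y) := odd_h x y _ hε (hb.imp And.left And.left)
    have fe1 := fe (k+1)
    have fo1 := fo (k+1)
    rw [show 2*(k+1) = 2*k+2 by ring] at *
    have hby : b ≤ y := by omega
    have hN : ∃ N, 2*N + 1 = 3*x+5*y ∧ ((x+y)*(x+4*y-1)+b)/(2*y) = N := by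
      obtain ⟨q, hq⟩ := hodd
      refine ⟨3*q+1+y, by omega, ?_⟩
      have hq' : (x:ℤ) + y = 2*q+1 := by exact_mod_cast hq
      rcases hb with ⟨hk, hb⟩ | ⟨hk, hb⟩
      · rw [hk] at hε
        refine div_eval _ _ (y-x) _ (by omega) ?_
        zify [show 1 ≤ x + 4*y by omega, hxy.le]
        have hb' : (b:ℤ) = y - 1 := by omega
        rw [hb']
        linear_combination hε + 3 * (y:ℤ) * hq'
      · rw [hk] at hε
        refine div_eval _ _ (y-x-1) _ (by omega) ?_
        zify [show 1 ≤ x + 4*y by omega, hxy.le, show 1 ≤ y - x by omega]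
        rw [hb]
        linear_combination hε + 3 * (y:ℤ) * hq'
    obtain ⟨N, hN1, hN2⟩ := hN
    have hst := step s hs (2*y) (x+y) b (x+4*y-1) N (by omega) (by omega) (by omega) hF hN2
    refine ⟨y, x+2*y, x+3*y-1-b, h3, ?_, ?_, by omega, by omega, ?_, ?_, ?_, ?_⟩
    · rw [fe1, h2, show 2*k+2+1 = 2*k+3 by ring, h3]; ring
    · rw [fo1, fe1, h2, show 2*k+2+1 = 2*k+3 by ring, h3]; ring
    · push_cast; rw [pow_succ]; linear_combination -hε
    · rw [pow_succ]
      rcases hb with ⟨hk, hb⟩ | ⟨hk, hb⟩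
      · right; rw [hk]; exact ⟨by norm_num, by omega⟩
      · left; rw [hk]; exact ⟨by norm_num, by omega⟩
    · obtain ⟨q, hq⟩ := hodd
      obtain ⟨c, hc⟩ := hbo
      exact ⟨(x+3*y-1-b)/2, by omega⟩
    · intro j hj
      have := hst j (by omega)
      rw [this]
      congr 1 <;> omega

theorem upper_right_corner_U (f : ℕ → ℕ) (hf : IsFSeq f) (s : ℕ → ℕ) (hs : IsFixedSeq s) :
    ∀ k : ℕ, 1 ≤ k →
      H s (f (2*k+1) / 2 + 1) (f (2*k+3) - 1) =
        (-1 : ℤ)^(k+1) * (f (2*k+1) / 2 : ℤ) := by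
  intro k _
  obtain ⟨x, y, b, h1, h2, h3, hx, hxy, hε, hb, hbo, hF⟩ := invariant f hf s hs k
  have hm := minor x y b (2*y-1) _ hx hxy (by omega) hε hb hbo
  rw [h1, h3, Nat.mul_div_cancel_left _ (by norm_num : 0 < 2)]
  have e : (((2*x : ℕ) : ℤ) / 2) = x := by push_cast; omega
  rw [e, pow_succ, mul_neg_one, ← hm, H]
  congr 1
  ext i j
  have hi := i.2
  have hj := j.2
  simp only [Matrix.of_apply]
  rw [hF _ (by omega)]
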